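/- Let X be a commutative and cocommutative Hopf algebra over a commutative ring k with S ∘ S = id, let λ : X → k be a two-sided integral functional, and define ∪ : X⊗X → k by ∪(a⊗b) = λ(a·S(b)). Let β : X^{⊗4} → X^{⊗4} be the braiding β(x⊗y⊗z⊗w) = z⁽¹⁾ ⊗ w⁽¹⁾ ⊗ x·S(z⁽²⁾)·w⁽²⁾ ⊗ y·S(z⁽³⁾)·w⁽³⁾. Then the cup commutes with the braiding: (id_{X⊗X} ⊗ ∪) ∘ β = ∪ ⊗ id_{X⊗X} and (∪ ⊗ id_{X⊗X}) ∘ β = id_{X⊗X} ⊗ ∪, as k-linear maps X^{⊗4} → X^{⊗2}. Explicitly, for all x,y,z,w ∈ X: z⁽¹⁾ ⊗ w⁽¹⁾ · λ( (x·S(z⁽²⁾)·w⁽²⁾)·S( y·S(z⁽³⁾)·w⁽³⁾ ) ) = λ(x·S(y)) · z ⊗ w, and λ( z⁽¹⁾·S(w⁽¹⁾) ) · (x·S(z⁽²⁾)·w⁽²⁾) ⊗ (y·S(z⁽³⁾)·w⁽³⁾) = λ(z·S(w)) · x ⊗ y. -/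

import Mathlib

open TensorProduct

/-- The finite family `(x1 i) ⊗ (x2 i)` represents the comultiplication of `x`. -/
def Rep2 (k : Type*) {X : Type*} [CommRing k] [AddCommMonoid X] [Module k X] [Coalgebra k X]
    (x : X) {n : ℕ} (x1 x2 : Fin n → X) : Prop :=
  Coalgebra.comul (R := k) x = ∑ i, x1 i ⊗ₜ[k] x2 i

/-- The twofold iterated comultiplication `x ↦ x⁽¹⁾ ⊗ (x⁽²⁾ ⊗ x⁽³⁾)`. -/
noncomputable def delta3 (k : Type*) {X : Type*} [CommRing k] [AddCommMonoid X] [Module k X]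
    [Coalgebra k X] : X →ₗ[k] X ⊗[k] (X ⊗[k] X) :=
  (LinearMap.lTensor X (Coalgebra.comul (R := k))) ∘ₗ Coalgebra.comul

/-- The finite family `(x1 i) ⊗ (x2 i) ⊗ (x3 i)` represents the iterated comultiplication
`x⁽¹⁾ ⊗ x⁽²⁾ ⊗ x⁽³⁾` of `x`. -/
def Rep3 (k : Type*) {X : Type*} [CommRing k] [AddCommMonoid X] [Module k X] [Coalgebra k X]
    (x : X) {n : ℕ} (x1 x2 x3 : Fin n → X) : Prop :=
  delta3 k x = ∑ i, x1 i ⊗ₜ[k] (x2 i ⊗ₜ[k] x3 i)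

/-- `lam` is a two-sided integral functional. -/
def IsIntegralFunctional (k : Type*) {X : Type*} [CommRing k] [Ring X] [HopfAlgebra k X]
    (lam : X →ₗ[k] k) : Prop :=
  ∀ (x : X) {n : ℕ} (x1 x2 : Fin n → X), Rep2 k x x1 x2 →
    (∑ i, lam (x2 i) • x1 i = lam x • (1 : X)) ∧ (∑ i, lam (x1 i) • x2 i = lam x • (1 : X))

open Coalgebra HopfAlgebra

section Aux

variable {k X : Type*} [CommRing k]

theorem exists_rep2 [AddCommMonoid X] [Module k X] [Coalgebra k X] (x : X) :
    ∃ (n : ℕ) (x1 x2 : Fin n → X), Rep2 k x x1 x2 := by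
  let r := Coalgebra.Repr.arbitrary k x
  refine ⟨r.index.card, fun i => r.left (r.index.equivFin.symm i),
    fun i => r.right (r.index.equivFin.symm i), ?_⟩
  rw [Rep2, ← r.eq, ← Finset.sum_coe_sort r.index]
  exact (Equiv.sum_comp r.index.equivFin.symm
    fun j : r.index => r.left j ⊗ₜ[k] r.right j).symm

theorem IsIntegralFunctional.lid_rTensor_comul [Ring X] [HopfAlgebra k X] {lam : X →ₗ[k] k}
    (hlam : IsIntegralFunctional k lam) (x : X) :
    TensorProduct.lid k X (lam.rTensor X (comul x)) = lam x • (1 : X) := by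
  obtain ⟨n, x1, x2, h⟩ := exists_rep2 (k := k) x
  rw [← (hlam x x1 x2 h).2, show comul x = _ from h]
  simp

variable [CommRing X] [HopfAlgebra k X]

/-- In a commutative and cocommutative Hopf algebra, the antipode is comultiplicative. -/
theorem comul_antipode_of_isCocomm [IsCocomm k X] (x : X) :
    comul (R := k) (antipode k x) =
      TensorProduct.map (antipode k) (antipode k) (comul (R := k) x) := by
  let i₁ : WithConv (X →ₐ[k] X ⊗[k] X) := .toConv Algebra.TensorProduct.includeLeft
  let i₂ : WithConv (X →ₐ[k] X ⊗[k] X) := .toConv Algebra.TensorProduct.includeRight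
  have aux : ∀ (f g : X →ₐ[k] X) (y : X),
      (WithConv.toConv ((Algebra.TensorProduct.includeLeft : X →ₐ[k] X ⊗[k] X).comp f) *
        WithConv.toConv ((Algebra.TensorProduct.includeRight : X →ₐ[k] X ⊗[k] X).comp g)) y =
      TensorProduct.map f.toLinearMap g.toLinearMap (comul (R := k) y) := by
    intro f g y
    rw [AlgHom.convMul_apply]
    generalize comul (R := k) y = t
    induction t with
    | zero => simp
    | add a b ha hb => simp only [map_add, ha, hb]
    | tmul a b => simp
  have h : (i₁ * i₂)⁻¹ = i₁⁻¹ * i₂⁻¹ := mul_inv i₁ i₂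
  have h' := congr($h x)
  have e1 : (i₁ * i₂)⁻¹ x = (i₁ * i₂) (antipode k x) := rfl
  rw [e1] at h'
  have e2 := aux (.id k X) (.id k X) (antipode k x)
  have e3 := aux (antipodeAlgHom k X) (antipodeAlgHom k X) x
  simp only [AlgHom.comp_id, AlgHom.toLinearMap_id, TensorProduct.map_id,
    LinearMap.id_apply] at e2
  exact e2.symm.trans (h'.trans e3)

theorem delta3_mul (x y : X) : delta3 k (x * y) = delta3 k x * delta3 k y := by
  have h (t : X) : delta3 k t =
      Algebra.TensorProduct.map (.id k X) (Bialgebra.comulAlgHom k X) (comul t) := rfl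
  simp only [h, Bialgebra.comul_mul, map_mul]

theorem delta3_antipode [IsCocomm k X] (x : X) :
    delta3 k (antipode k x) =
      TensorProduct.map (antipode k) (TensorProduct.map (antipode k) (antipode k))
        (delta3 k x) := by
  simp only [delta3, LinearMap.comp_apply, comul_antipode_of_isCocomm]
  generalize comul (R := k) x = t
  induction t with
  | zero => simp
  | add a b ha hb => simp only [map_add, ha, hb]
  | tmul a b => simp [comul_antipode_of_isCocomm]

theorem IsIntegralFunctional.map_delta3 {lam : X →ₗ[k] k} (hlam : IsIntegralFunctional k lam)
    (x : X) :
    TensorProduct.lid k (X ⊗[k] X) (lam.rTensor (X ⊗[k] X) (delta3 k x)) =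
      lam x • (1 : X ⊗[k] X) := by
  have h : lam x • (1 : X ⊗[k] X) = comul (R := k) (lam x • (1 : X)) := by simp
  rw [h, ← hlam.lid_rTensor_comul, delta3, LinearMap.comp_apply]
  generalize comul (R := k) x = t
  induction t with
  | zero => simp
  | add a b ha hb => simp only [map_add, ha, hb]
  | tmul a b => simp

theorem Rep3.sum_tmul_antipode_mul {x : X} {n : ℕ} {x1 x2 x3 : Fin n → X}
    (h : Rep3 k x x1 x2 x3) :
    ∑ i, x1 i ⊗ₜ[k] (antipode k (x2 i) * x3 i) = x ⊗ₜ[k] 1 := by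
  have e := congr((LinearMap.mul' k X ∘ₗ (antipode k).rTensor X).lTensor X $h)
  simp only [map_sum, LinearMap.lTensor_tmul, LinearMap.comp_apply, LinearMap.rTensor_tmul,
    LinearMap.mul'_apply] at e
  rw [← e, delta3, ← LinearMap.comp_apply, ← LinearMap.comp_assoc, ← LinearMap.lTensor_comp,
    LinearMap.comp_assoc, mul_antipode_rTensor_comul, LinearMap.lTensor_comp]
  simp

theorem Rep3.sum_tmul_mul_antipode {x : X} {n : ℕ} {x1 x2 x3 : Fin n → X}
    (h : Rep3 k x x1 x2 x3) :
    ∑ i, x1 i ⊗ₜ[k] (x2 i * antipode k (x3 i)) = x ⊗ₜ[k] 1 := by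
  have e := congr((LinearMap.mul' k X ∘ₗ (antipode k).lTensor X).lTensor X $h)
  simp only [map_sum, LinearMap.lTensor_tmul, LinearMap.comp_apply,
    LinearMap.mul'_apply] at e
  rw [← e, delta3, ← LinearMap.comp_apply, ← LinearMap.comp_assoc, ← LinearMap.lTensor_comp,
    LinearMap.comp_assoc, mul_antipode_lTensor_comul, LinearMap.lTensor_comp]
  simp

end Aux

/-- the cup `∪(a⊗b) = λ(a·S(b))` commutes with the braiding
`β(x⊗y⊗z⊗w) = z⁽¹⁾ ⊗ w⁽¹⁾ ⊗ x·S(z⁽²⁾)·w⁽²⁾ ⊗ y·S(z⁽³⁾)·w⁽³⁾`: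
`(id ⊗ ∪) ∘ β = ∪ ⊗ id` and `(∪ ⊗ id) ∘ β = id ⊗ ∪`. -/
theorem cup_commutes_with_braiding (k X : Type*) [CommRing k] [CommRing X] [HopfAlgebra k X]
    (S : X →ₗ[k] X) (hS : S = HopfAlgebra.antipode (R := k))
    (hinv : ∀ a : X, S (S a) = a)
    (hcc : ∀ a : X, TensorProduct.comm k X X (Coalgebra.comul a) = Coalgebra.comul a)
    (lam : X →ₗ[k] k) (hlam : IsIntegralFunctional k lam)
    (x y z w : X) {n m : ℕ} (z1 z2 z3 : Fin n → X) (w1 w2 w3 : Fin m → X)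
    (hz : Rep3 k z z1 z2 z3) (hw : Rep3 k w w1 w2 w3) :
    (∑ i, ∑ j, lam ((x * S (z2 i) * w2 j) * S (y * S (z3 i) * w3 j)) • (z1 i ⊗ₜ[k] w1 j) =
      lam (x * S y) • (z ⊗ₜ[k] w)) ∧
    (∑ i, ∑ j, lam (z1 i * S (w1 j)) •
        ((x * S (z2 i) * w2 j) ⊗ₜ[k] (y * S (z3 i) * w3 j)) =
      lam (z * S w) • (x ⊗ₜ[k] y)) := by
  subst hS
  have : IsCocomm k X := ⟨LinearMap.ext hcc⟩
  constructor
  · let G : (X ⊗[k] X) ⊗[k] (X ⊗[k] X) →ₗ[k] X ⊗[k] X :=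
      (TensorProduct.rid k (X ⊗[k] X)).toLinearMap ∘ₗ
        (lam ∘ₗ LinearMap.mulLeft k (x * antipode k y) ∘ₗ
          LinearMap.mul' k X).lTensor (X ⊗[k] X) ∘ₗ
        (TensorProduct.tensorTensorTensorComm k X X X X).toLinearMap
    have hG (a b c d : X) : G ((a ⊗ₜ b) ⊗ₜ (c ⊗ₜ d)) =
        lam (x * antipode k y * (b * d)) • (a ⊗ₜ[k] c) := by simp [G, mul_assoc]
    have h := hG z 1 w 1
    rw [← hz.sum_tmul_antipode_mul, ← hw.sum_tmul_mul_antipode, TensorProduct.sum_tmul] at h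
    simp only [TensorProduct.tmul_sum, map_sum, hG, mul_one] at h
    rw [← h]
    refine Finset.sum_congr rfl fun i _ => Finset.sum_congr rfl fun j _ => ?_
    rw [antipode_mul_distrib, antipode_mul_distrib, hinv]
    congr 2
    ring
  · have h := hlam.map_delta3 (z * antipode k w)
    rw [delta3_mul, delta3_antipode, show delta3 k z = _ from hz,
      show delta3 k w = _ from hw] at h
    simp only [map_sum, TensorProduct.map_tmul, Finset.sum_mul_sum,
      Algebra.TensorProduct.tmul_mul_tmul, LinearMap.rTensor_tmul, TensorProduct.lid_tmul] at h
    have h2 := congr((x ⊗ₜ[k] y) * TensorProduct.map (antipode k) (antipode k) $h)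
    simp only [map_sum, map_smul, TensorProduct.map_tmul, antipode_mul_distrib, hinv,
      Algebra.TensorProduct.one_def, antipode_one, Finset.mul_sum, mul_smul_comm,
      Algebra.TensorProduct.tmul_mul_tmul, mul_one, ← mul_assoc] at h2
    exact h2
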